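/- Let f : ℝ → ℝ be a C^∞ function that is even, i.e. f(-x) = f(x) for all x. Then there exists a C^∞ function g : ℝ → ℝ such that g(x²) = f(x) for all x ∈ ℝ. -/

import Mathlib

theorem contDiff_of_chain (G : ℕ → ℝ → ℝ) (h : ∀ k x, HasDerivAt (G k) (G (k+1) x) x) (k : ℕ) :
    ContDiff ℝ (⊤ : ℕ∞) (G k) := by
  have key : ∀ n : ℕ, ∀ k, ContDiff ℝ n (G k) := by
    intro n
    induction n with
    | zero =>
      intro k
      have : Continuous (G k) := continuous_iff_continuousAt.2 fun x => (h k x).continuousAt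
      exact_mod_cast contDiff_zero.2 this
    | succ n ih =>
      intro k
      have h1 : deriv (G k) = G (k+1) := funext fun x => (h k x).deriv
      push_cast
      rw [contDiff_succ_iff_deriv]
      refine ⟨fun x => (h k x).differentiableAt, by simp, ?_⟩
      rw [h1]
      exact ih _
  exact contDiff_infty.2 fun n => key n k

theorem borel_chain (a : ℕ → ℝ) : ∃ b : ℕ → ℝ → ℝ,
    (∀ k x, HasDerivAt (b k) (b (k+1) x) x) ∧ ∀ k, b k 0 = a k := by
  let χ : ContDiffBump (0 : ℝ) := ⟨1, 2, by norm_num, by norm_num⟩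
  let φ : ℕ → ℝ → ℝ := fun n x => χ x * x ^ n
  have hφ : ∀ n, ContDiff ℝ (⊤ : ℕ∞) (φ n) := fun n => χ.contDiff.mul (contDiff_id.pow n)
  have hφc : ∀ n, HasCompactSupport (φ n) := fun n => χ.hasCompactSupport.mul_right
  let D : ℕ → ℕ → ℝ → ℝ := fun n k => iteratedDeriv k (φ n)
  have hDs : ∀ n k, ContDiff ℝ (⊤ : ℕ∞) (D n k) := by
    intro n k
    simp only [D, iteratedDeriv_eq_iterate]
    exact ContDiff.iterate_deriv k (hφ n)
  have hDc : ∀ n k, HasCompactSupport (D n k) := by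
    intro n k
    induction k with
    | zero => simpa [D] using hφc n
    | succ k ih =>
      simp only [D, iteratedDeriv_succ]
      exact ih.deriv
  have hDd : ∀ n k x, HasDerivAt (D n k) (D n (k+1) x) x := by
    intro n k x
    have : D n (k+1) x = deriv (D n k) x := by simp only [D, iteratedDeriv_succ]
    rw [this]
    exact ((hDs n k).differentiable (by simp) x).hasDerivAt
  have hD0 : ∀ n k, D n k 0 = if k = n then (n.factorial : ℝ) else 0 := by
    intro n k
    have h1 : φ n =ᶠ[nhds 0] fun x => x ^ n := by
      filter_upwards [χ.eventuallyEq_one] with x hx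
      simp [φ, hx]
    simp only [D]
    rw [h1.iteratedDeriv_eq k, iteratedDeriv_fun_pow_zero]
    try split_ifs <;> simp_all
  have hDb : ∀ n k, ∃ C, ∀ x, ‖D n k x‖ ≤ C := fun n k =>
    (hDc n k).exists_bound_of_continuous (hDs n k).continuous
  choose B hB using hDb
  have hB0 : ∀ n k, 0 ≤ B n k := fun n k => (norm_nonneg _).trans (hB n k 0)
  let c : ℕ → ℝ := fun n => a n / n.factorial
  let M : ℕ → ℝ := fun n => ∑ k ∈ Finset.range n, B n k
  have hM0 : ∀ n, 0 ≤ M n := fun n => Finset.sum_nonneg fun k _ => hB0 n k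
  let L : ℕ → ℝ := fun n => 1 + 2 ^ n * (|c n| * M n)
  have hL1 : ∀ n, 1 ≤ L n := fun n => by
    have : 0 ≤ 2 ^ n * (|c n| * M n) := mul_nonneg (by positivity) (mul_nonneg (abs_nonneg _) (hM0 n))
    simp only [L]; linarith
  have hLp : ∀ n, 0 < L n := fun n => one_pos.trans_le (hL1 n)
  let T : ℕ → ℕ → ℝ → ℝ := fun k n x => c n * (L n ^ k / L n ^ n) * D n k (L n * x)
  let u : ℕ → ℕ → ℝ := fun k n => |c n| * (L n ^ k / L n ^ n) * B n k
  have hTu : ∀ k n x, ‖T k n x‖ ≤ u k n := by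
    intro k n x
    have h1 : 0 ≤ L n ^ k / L n ^ n := by have := hLp n; positivity
    simp only [T, u, norm_mul, Real.norm_eq_abs, abs_of_nonneg h1]
    exact mul_le_mul_of_nonneg_left (hB n k _) (mul_nonneg (abs_nonneg _) h1)
  have hu : ∀ k, Summable (u k) := by
    intro k
    refine Summable.of_norm_bounded_eventually_nat (g := fun n => (1/2 : ℝ) ^ n)
      (summable_geometric_of_lt_one (by norm_num) (by norm_num)) ?_
    filter_upwards [Filter.eventually_gt_atTop k] with n hn
    have hp := hLp n
    have h1 : 0 ≤ L n ^ k / L n ^ n := by positivity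
    have h2 : L n ^ k / L n ^ n ≤ 1 / L n := by
      rw [div_le_div_iff₀ (by positivity) hp, one_mul, ← pow_succ]
      exact pow_le_pow_right₀ (hL1 n) hn
    have h3 : B n k ≤ M n :=
      Finset.single_le_sum (f := fun k => B n k) (fun i _ => hB0 n i) (Finset.mem_range.2 hn)
    have h0 : 0 ≤ u k n := mul_nonneg (mul_nonneg (abs_nonneg _) h1) (hB0 n k)
    rw [Real.norm_of_nonneg h0]
    calc u k n ≤ |c n| * (1 / L n) * M n := by
          simp only [u]
          exact mul_le_mul (mul_le_mul_of_nonneg_left h2 (abs_nonneg _)) h3 (hB0 n k)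
            (by positivity)
      _ = (|c n| * M n) / L n := by ring
      _ ≤ (1/2 : ℝ) ^ n := by
          rw [div_le_iff₀ hp, one_div, inv_pow, inv_mul_eq_div, le_div_iff₀ (by positivity)]
          simp only [L]; linarith
  have hTd : ∀ k n x, HasDerivAt (T k n) (T (k+1) n x) x := by
    intro k n x
    have h1 : HasDerivAt (fun x => L n * x) (L n) x := by
      simpa using (hasDerivAt_id x).const_mul (L n)
    have h2 := ((hDd n k (L n * x)).comp x h1).const_mul (c n * (L n ^ k / L n ^ n))
    refine h2.congr_deriv ?_
    simp only [T, pow_succ]; ring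
  have hTs : ∀ k x, Summable fun n => T k n x := fun k x =>
    Summable.of_norm_bounded (hu k) (fun n => hTu k n x)
  refine ⟨fun k x => ∑' n, T k n x, fun k x => ?_, fun k => ?_⟩
  · exact hasDerivAt_tsum (hu (k+1)) (hTd k) (hTu (k+1)) (hTs k 0) x
  · show ∑' n, T k n 0 = a k
    rw [tsum_eq_single k]
    · have := (hLp k).ne'
      have h2 : (k.factorial : ℝ) ≠ 0 := by positivity
      simp only [T, mul_zero, hD0, c, if_true]
      field_simp
    · intro n hn
      simp [T, hD0, hn.symm]

theorem hadamard_smooth (q : ℝ → ℝ) (hq : ContDiff ℝ (⊤ : ℕ∞) q) (h0 : q 0 = 0) :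
    ∃ r : ℝ → ℝ, ContDiff ℝ (⊤ : ℕ∞) r ∧ ∀ x, q x = x * r x := by
  let D : ℕ → ℝ → ℝ := fun k => iteratedDeriv (k+1) q
  have hDs : ∀ k, ContDiff ℝ (⊤ : ℕ∞) (D k) := by
    intro k
    simp only [D, iteratedDeriv_eq_iterate]
    exact ContDiff.iterate_deriv (k+1) hq
  have hDd : ∀ k x, HasDerivAt (D k) (D (k+1) x) x := by
    intro k x
    have : D (k+1) x = deriv (D k) x := by
      simp only [D]; rw [iteratedDeriv_succ]
    rw [this]
    exact ((hDs k).differentiable (by simp) x).hasDerivAt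
  let G : ℕ → ℝ → ℝ := fun k x => ∫ t in (0:ℝ)..1, t ^ k * D k (x * t)
  have hG : ∀ k x, HasDerivAt (G k) (G (k+1) x) x := by
    intro k x
    have hc : ∀ k y, Continuous fun t : ℝ => t ^ k * D k (y * t) := fun k y =>
      (continuous_id.pow k).mul ((hDs k).continuous.comp (continuous_const.mul continuous_id))
    have hc2 : Continuous fun p : ℝ × ℝ => p.2 ^ (k+1) * D (k+1) (p.1 * p.2) :=
      (continuous_snd.pow _).mul ((hDs (k+1)).continuous.comp (continuous_fst.mul continuous_snd))
    obtain ⟨C, hC⟩ := ((isCompact_closedBall x 1).prod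
      (isCompact_Icc (a := (0:ℝ)) (b := 1))).exists_bound_of_continuousOn hc2.continuousOn
    refine (intervalIntegral.hasDerivAt_integral_of_dominated_loc_of_deriv_le
      (F := fun y t => t ^ k * D k (y * t)) (F' := fun y t => t ^ (k+1) * D (k+1) (y * t))
      (bound := fun _ => C) (s := Metric.closedBall x 1)
      (Metric.closedBall_mem_nhds x one_pos) ?_ ?_ ?_ ?_ ?_ ?_).2
    · exact Filter.Eventually.of_forall fun y => (hc k y).aestronglyMeasurable
    · exact (hc k x).intervalIntegrable _ _
    · exact (hc (k+1) x).aestronglyMeasurable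
    · refine Filter.Eventually.of_forall fun t ht y hy => hC (y, t) ⟨hy, ?_⟩
      rw [Set.uIoc_of_le zero_le_one] at ht
      exact ⟨ht.1.le, ht.2⟩
    · exact intervalIntegrable_const
    · refine Filter.Eventually.of_forall fun t _ y _ => ?_
      have h1 : HasDerivAt (fun y => y * t) t y := by
        simpa using (hasDerivAt_id y).mul_const t
      have h2 := ((hDd k (y * t)).comp y h1).const_mul (t ^ k)
      refine h2.congr_deriv ?_
      rw [pow_succ]; ring
  refine ⟨G 0, contDiff_of_chain G hG 0, fun x => ?_⟩
  have hd : ∀ y, HasDerivAt q (D 0 y) y := fun y => by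
    simp only [D, zero_add, iteratedDeriv_one]
    exact (hq.differentiable (by simp) y).hasDerivAt
  have hi : ∫ t in (0:ℝ)..1, x * D 0 (x * t) = q (x * 1) - q (x * 0) := by
    refine intervalIntegral.integral_eq_sub_of_hasDerivAt (f := fun t => q (x * t)) (fun t _ => ?_) ?_
    · have h1 : HasDerivAt (fun t => x * t) x t := by
        simpa using (hasDerivAt_id t).const_mul x
      refine ((hd (x * t)).comp t h1).congr_deriv (by ring)
    · exact (continuous_const.mul ((hDs 0).continuous.comp
        (continuous_const.mul continuous_id))).intervalIntegrable _ _
  simp only [mul_one, mul_zero, h0, sub_zero] at hi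
  rw [← hi, intervalIntegral.integral_const_mul]
  simp [G]

theorem even_step (f : ℝ → ℝ) (hf : ContDiff ℝ (⊤ : ℕ∞) f) (heven : ∀ x : ℝ, f (-x) = f x) :
    ∃ h : ℝ → ℝ, (ContDiff ℝ (⊤ : ℕ∞) h ∧ ∀ x, h (-x) = h x) ∧
      ∀ x, HasDerivAt f (2 * x * h x) x := by
  have hd : ∀ x, HasDerivAt f (deriv f x) x := fun x =>
    (hf.differentiable (by simp) x).hasDerivAt
  have hodd : ∀ x, deriv f (-x) = - deriv f x := by
    intro x
    have h1 := (hd (-x)).comp x (hasDerivAt_neg x)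
    have h2 : f ∘ Neg.neg = f := funext heven
    have h3 : HasDerivAt f (deriv f (-x) * -1) x := by
      rw [← h2] at h1 ⊢
      simpa [h2] using h1
    have := h3.unique (hd x)
    linarith
  have h0 : deriv f 0 = 0 := by
    have := hodd 0
    rw [neg_zero] at this
    linarith
  obtain ⟨r, hr, hrx⟩ := hadamard_smooth (deriv f) (contDiff_infty_iff_deriv.1 hf).2 h0
  refine ⟨fun x => r x / 2, ⟨hr.div_const 2, fun x => ?_⟩, fun x => ?_⟩
  · rcases eq_or_ne x 0 with rfl | hx
    · simp
    · have h1 := hodd x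
      rw [hrx, hrx x] at h1
      have : x * r (-x) = x * r x := by linarith
      show r (-x) / 2 = r x / 2
      rw [mul_left_cancel₀ hx this]
  · refine (hd x).congr_deriv ?_
    rw [hrx]; ring

/-- Whitney's theorem: an even smooth function of `x` is a smooth function of `x²`. -/
theorem whitney_even_smooth (f : ℝ → ℝ) (hf : ContDiff ℝ (⊤ : ℕ∞) f)
    (heven : ∀ x : ℝ, f (-x) = f x) :
    ∃ g : ℝ → ℝ, ContDiff ℝ (⊤ : ℕ∞) g ∧ ∀ x : ℝ, g (x ^ 2) = f x := by
  have hstep : ∀ s : {f : ℝ → ℝ // ContDiff ℝ (⊤ : ℕ∞) f ∧ ∀ x, f (-x) = f x},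
      ∃ t : {f : ℝ → ℝ // ContDiff ℝ (⊤ : ℕ∞) f ∧ ∀ x, f (-x) = f x},
        ∀ x, HasDerivAt s.1 (2 * x * t.1 x) x := by
    rintro ⟨s, hs, he⟩
    obtain ⟨h, hh, hx⟩ := even_step s hs he
    exact ⟨⟨h, hh⟩, hx⟩
  choose step hstep using hstep
  let F : ℕ → ℝ → ℝ := fun k => (step^[k] ⟨f, hf, heven⟩).1
  have hF : ∀ k x, HasDerivAt (F k) (2 * x * F (k+1) x) x := by
    intro k x
    simp only [F, Function.iterate_succ_apply']
    exact hstep _ x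
  obtain ⟨b, hb, hb0⟩ := borel_chain fun k => F k 0
  let G : ℕ → ℝ → ℝ := fun k u => if 0 ≤ u then F k (Real.sqrt u) else b k u
  have hGc : ∀ k, Continuous (G k) := by
    intro k
    have h1 : Continuous (F k) := continuous_iff_continuousAt.2 fun x => (hF k x).continuousAt
    have h2 : Continuous (b k) := continuous_iff_continuousAt.2 fun x => (hb k x).continuousAt
    refine Continuous.if_le (h1.comp Real.continuous_sqrt) h2 continuous_const continuous_id ?_
    rintro x rfl
    simp [hb0]
  have hG : ∀ k x, HasDerivAt (G k) (G (k+1) x) x := by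
    intro k
    refine hasDerivAt_of_hasDerivAt_of_ne' (x := 0) (fun y hy => ?_) (hGc k).continuousAt
      (hGc (k+1)).continuousAt
    rcases lt_or_gt_of_ne hy with h | h
    · have h1 : G (k+1) y = b (k+1) y := if_neg (not_le.2 h)
      rw [h1]
      refine (hb k y).congr_of_eventuallyEq ?_
      filter_upwards [Iio_mem_nhds h] with z hz
      exact if_neg (not_le.2 hz)
    · have h1 : G (k+1) y = F (k+1) (Real.sqrt y) := if_pos h.le
      rw [h1]
      have h2 := (hF k (Real.sqrt y)).comp y (Real.hasDerivAt_sqrt hy)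
      have h3 : Real.sqrt y ≠ 0 := (Real.sqrt_pos.2 h).ne'
      refine (h2.congr_deriv (by field_simp)).congr_of_eventuallyEq ?_
      filter_upwards [Ioi_mem_nhds h] with z hz
      exact if_pos (le_of_lt hz)
  refine ⟨G 0, contDiff_of_chain G hG 0, fun x => ?_⟩
  have h1 : G 0 (x ^ 2) = f |x| := by
    simp [G, F, sq_nonneg, Real.sqrt_sq_eq_abs]
  rw [h1]
  rcases abs_choice x with h | h <;> rw [h]
  exact heven x
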